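/- arXiv:1501.03955 — 3 statements merged into one kernel-verified Lean document; each statement's English description precedes it below -/
import Mathlib

section
/- Let M be an ordered Γ-groupoid and μ a fuzzy subset of M. If μ is a fuzzy prime ideal of M, then every nonempty level subset μ_t = {x ∈ M : μ(x) ≥ t} (t ∈ [0,1]) is a prime ideal of M; conversely, if every nonempty level subset μ_t is a prime ideal of M, then μ is a fuzzy prime ideal of M. -/
variable {M Γ : Type*}

/-- A fuzzy subset of `M`: a map into `[0,1]`. -/
def FuzzySet (μ : M → ℝ) : Prop := ∀ x, μ x ∈ Set.Icc (0:ℝ) 1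

/-- Compatibility of the Γ-operation with the order: this makes `(M, ≤, op)`
an ordered Γ-groupoid. -/
def IsCompatible [PartialOrder M] (op : M → Γ → M → M) : Prop :=
  ∀ ⦃a b : M⦄, a ≤ b → ∀ (γ : Γ) (c : M), op a γ c ≤ op b γ c ∧ op c γ a ≤ op c γ b

/-- The `t`-level subset `μ_t = {x ∈ M : μ(x) ≥ t}`. -/
def LevelSet (μ : M → ℝ) (t : ℝ) : Set M := {x | t ≤ μ x}

/-- A left ideal of an ordered Γ-groupoid. -/
def IsLeftIdeal [PartialOrder M] (op : M → Γ → M → M) (A : Set M) : Prop :=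
  A.Nonempty ∧ (∀ (a : M) (γ : Γ), ∀ b ∈ A, op a γ b ∈ A) ∧
    ∀ a ∈ A, ∀ b : M, b ≤ a → b ∈ A

/-- A right ideal of an ordered Γ-groupoid. -/
def IsRightIdeal [PartialOrder M] (op : M → Γ → M → M) (A : Set M) : Prop :=
  A.Nonempty ∧ (∀ a ∈ A, ∀ (γ : Γ) (b : M), op a γ b ∈ A) ∧
    ∀ a ∈ A, ∀ b : M, b ≤ a → b ∈ A

/-- An ideal of an ordered Γ-groupoid: both a left and a right ideal. -/
def IsIdeal [PartialOrder M] (op : M → Γ → M → M) (A : Set M) : Prop :=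
  IsLeftIdeal op A ∧ IsRightIdeal op A

/-- A prime subset: `aγb ∈ T` implies `a ∈ T` or `b ∈ T`. -/
def IsPrimeSubset (op : M → Γ → M → M) (T : Set M) : Prop :=
  ∀ (a b : M) (γ : Γ), op a γ b ∈ T → a ∈ T ∨ b ∈ T

/-- A semiprime subset: `aγa ∈ T` implies `a ∈ T`. -/
def IsSemiprimeSubset (op : M → Γ → M → M) (T : Set M) : Prop :=
  ∀ (a : M) (γ : Γ), op a γ a ∈ T → a ∈ T

/-- A fuzzy left ideal: `μ(xγy) ≥ μ(y)` and `x ≤ y → μ(x) ≥ μ(y)`. -/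
def IsFuzzyLeftIdeal [PartialOrder M] (op : M → Γ → M → M) (μ : M → ℝ) : Prop :=
  FuzzySet μ ∧ (∀ (x y : M) (γ : Γ), μ y ≤ μ (op x γ y)) ∧
    ∀ ⦃x y : M⦄, x ≤ y → μ y ≤ μ x

/-- A fuzzy right ideal: `μ(xγy) ≥ μ(x)` and `x ≤ y → μ(x) ≥ μ(y)`. -/
def IsFuzzyRightIdeal [PartialOrder M] (op : M → Γ → M → M) (μ : M → ℝ) : Prop :=
  FuzzySet μ ∧ (∀ (x y : M) (γ : Γ), μ x ≤ μ (op x γ y)) ∧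
    ∀ ⦃x y : M⦄, x ≤ y → μ y ≤ μ x

/-- A fuzzy ideal: `μ(xγy) ≥ max{μ(x), μ(y)}` and `x ≤ y → μ(x) ≥ μ(y)`. -/
def IsFuzzyIdeal [PartialOrder M] (op : M → Γ → M → M) (μ : M → ℝ) : Prop :=
  FuzzySet μ ∧ (∀ (x y : M) (γ : Γ), max (μ x) (μ y) ≤ μ (op x γ y)) ∧
    ∀ ⦃x y : M⦄, x ≤ y → μ y ≤ μ x

/-- A fuzzy prime subset: `μ(xγy) ≤ max{μ(x), μ(y)}`. -/
def IsFuzzyPrimeSubset (op : M → Γ → M → M) (μ : M → ℝ) : Prop :=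
  ∀ (x y : M) (γ : Γ), μ (op x γ y) ≤ max (μ x) (μ y)

/-- A fuzzy semiprime subset: `μ(x) ≥ μ(xγx)`. -/
def IsFuzzySemiprimeSubset (op : M → Γ → M → M) (μ : M → ℝ) : Prop :=
  ∀ (x : M) (γ : Γ), μ (op x γ x) ≤ μ x

/-- The componentwise operation on `M × M`: `(a,b)γ(c,d) = (aγc, bγd)`. -/
def prodOp (op : M → Γ → M → M) : M × M → Γ → M × M → M × M :=
  fun p γ q => (op p.1 γ q.1, op p.2 γ q.2)

/-- The cartesian product of two fuzzy subsets: `(μ × σ)(x,y) = min{μ(x), σ(y)}`. -/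
def prodFuzzy (μ σ : M → ℝ) : M × M → ℝ := fun p => min (μ p.1) (σ p.2)

/-- If `μ` is a fuzzy prime ideal, then every nonempty level subset `μ_t`
(`t ∈ [0,1]`) is a prime ideal; conversely, if every nonempty level subset is a
prime ideal, then `μ` is a fuzzy prime ideal. -/
theorem stmt6 [PartialOrder M] [Nonempty M] [Nonempty Γ]
    (op : M → Γ → M → M) (hop : IsCompatible op) (μ : M → ℝ)
    (hμ : FuzzySet μ) :
    (IsFuzzyIdeal op μ ∧ IsFuzzyPrimeSubset op μ →
      ∀ t ∈ Set.Icc (0:ℝ) 1, (LevelSet μ t).Nonempty →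
        IsIdeal op (LevelSet μ t) ∧ IsPrimeSubset op (LevelSet μ t)) ∧
    ((∀ t ∈ Set.Icc (0:ℝ) 1, (LevelSet μ t).Nonempty →
        IsIdeal op (LevelSet μ t) ∧ IsPrimeSubset op (LevelSet μ t)) →
      IsFuzzyIdeal op μ ∧ IsFuzzyPrimeSubset op μ) := by
  constructor
  · rintro ⟨⟨_, hmul, hanti⟩, hprime⟩ t _ hne
    have hlower : ∀ a ∈ LevelSet μ t, ∀ b : M, b ≤ a → b ∈ LevelSet μ t :=
      fun a ha b hba => le_trans ha (hanti hba)
    refine ⟨⟨⟨hne, fun a γ b hb => ?_, hlower⟩, ⟨hne, fun a ha γ b => ?_, hlower⟩⟩,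
      fun a b γ h => ?_⟩
    · exact le_trans hb ((le_max_right _ _).trans (hmul a b γ))
    · exact le_trans ha ((le_max_left _ _).trans (hmul a b γ))
    · exact le_max_iff.mp (le_trans h (hprime a b γ))
  · intro h
    have hlevel (x : M) := h (μ x) (hμ x) ⟨x, le_refl (μ x)⟩
    refine ⟨⟨hμ, fun x y γ => max_le ?_ ?_, fun x y hxy => ?_⟩, fun x y γ => ?_⟩
    · exact (hlevel x).1.2.2.1 x (le_refl (μ x)) γ y
    · exact (hlevel y).1.1.2.1 x γ y (le_refl (μ y))
    · exact (hlevel y).1.1.2.2 y (le_refl (μ y)) x hxy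
    · exact le_max_iff.mpr ((hlevel (op x γ y)).2 x y γ (le_refl (μ (op x γ y))))
end

section
/- Let M be an ordered Γ-groupoid and μ, σ fuzzy left ideals of M. Then for every t ∈ [0,1] for which the level subset (μ × σ)_t = {(x,y) ∈ M × M : min{μ(x), σ(y)} ≥ t} is nonempty, (μ × σ)_t is a left ideal of the ordered Γ-groupoid M × M (with componentwise operation and order). The analogous statement holds for fuzzy right ideals: if μ, σ are fuzzy right ideals of M, then every nonempty (μ × σ)_t is a right ideal of M × M. -/
variable {M Γ : Type*}

theorem FuzzySet.prodFuzzy {μ σ : M → ℝ} (hμ : FuzzySet μ) (hσ : FuzzySet σ) :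
    FuzzySet (prodFuzzy μ σ) :=
  fun x => ⟨le_min (hμ x.1).1 (hσ x.2).1, (min_le_left _ _).trans (hμ x.1).2⟩

theorem IsFuzzyLeftIdeal.isFuzzyLeftIdeal_prodFuzzy [PartialOrder M] {op : M → Γ → M → M}
    {μ σ : M → ℝ} (hμ : IsFuzzyLeftIdeal op μ) (hσ : IsFuzzyLeftIdeal op σ) :
    IsFuzzyLeftIdeal (prodOp op) (prodFuzzy μ σ) :=
  ⟨hμ.1.prodFuzzy hσ.1,
    fun x y γ => min_le_min (hμ.2.1 x.1 y.1 γ) (hσ.2.1 x.2 y.2 γ),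
    fun _ _ h => min_le_min (hμ.2.2 h.1) (hσ.2.2 h.2)⟩

theorem IsFuzzyLeftIdeal.isLeftIdeal_levelSet [PartialOrder M] {op : M → Γ → M → M}
    {μ : M → ℝ} (hμ : IsFuzzyLeftIdeal op μ) {t : ℝ} (ht : (LevelSet μ t).Nonempty) :
    IsLeftIdeal op (LevelSet μ t) :=
  ⟨ht, fun a γ b hb => le_trans hb (hμ.2.1 a b γ), fun _ ha _ hba => le_trans ha (hμ.2.2 hba)⟩

theorem IsFuzzyRightIdeal.isFuzzyRightIdeal_prodFuzzy [PartialOrder M] {op : M → Γ → M → M}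
    {μ σ : M → ℝ} (hμ : IsFuzzyRightIdeal op μ) (hσ : IsFuzzyRightIdeal op σ) :
    IsFuzzyRightIdeal (prodOp op) (prodFuzzy μ σ) :=
  ⟨hμ.1.prodFuzzy hσ.1,
    fun x y γ => min_le_min (hμ.2.1 x.1 y.1 γ) (hσ.2.1 x.2 y.2 γ),
    fun _ _ h => min_le_min (hμ.2.2 h.1) (hσ.2.2 h.2)⟩

theorem IsFuzzyRightIdeal.isRightIdeal_levelSet [PartialOrder M] {op : M → Γ → M → M}
    {μ : M → ℝ} (hμ : IsFuzzyRightIdeal op μ) {t : ℝ} (ht : (LevelSet μ t).Nonempty) :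
    IsRightIdeal op (LevelSet μ t) :=
  ⟨ht, fun a ha γ b => le_trans ha (hμ.2.1 a b γ), fun _ ha _ hba => le_trans ha (hμ.2.2 hba)⟩

/-- If `μ, σ` are fuzzy left (resp. right) ideals of `M`, then every nonempty
level subset `(μ × σ)_t` (`t ∈ [0,1]`) is a left (resp. right) ideal of
`M × M`. -/
theorem stmt17 [PartialOrder M] [Nonempty M] [Nonempty Γ]
    (op : M → Γ → M → M) (hop : IsCompatible op) (μ σ : M → ℝ) :
    (IsFuzzyLeftIdeal op μ → IsFuzzyLeftIdeal op σ →
      ∀ t ∈ Set.Icc (0:ℝ) 1, (LevelSet (prodFuzzy μ σ) t).Nonempty →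
        IsLeftIdeal (prodOp op) (LevelSet (prodFuzzy μ σ) t)) ∧
    (IsFuzzyRightIdeal op μ → IsFuzzyRightIdeal op σ →
      ∀ t ∈ Set.Icc (0:ℝ) 1, (LevelSet (prodFuzzy μ σ) t).Nonempty →
        IsRightIdeal (prodOp op) (LevelSet (prodFuzzy μ σ) t)) := by
  exact ⟨fun hμ hσ _ _ ht => (hμ.isFuzzyLeftIdeal_prodFuzzy hσ).isLeftIdeal_levelSet ht,
    fun hμ hσ _ _ ht => (hμ.isFuzzyRightIdeal_prodFuzzy hσ).isRightIdeal_levelSet ht⟩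
end

section
/- Let M be an ordered Γ-groupoid and μ, σ fuzzy ideals of M. Then for every t ∈ [0,1] for which the level subset (μ × σ)_t = {(x,y) ∈ M × M : min{μ(x), σ(y)} ≥ t} is nonempty, (μ × σ)_t is an ideal of the ordered Γ-groupoid M × M (with componentwise operation and order). -/
variable {M Γ : Type*}

/-- If `μ, σ` are fuzzy ideals of `M`, then every nonempty level subset
`(μ × σ)_t` (`t ∈ [0,1]`) is an ideal of `M × M`. -/
theorem stmt18 [PartialOrder M] [Nonempty M] [Nonempty Γ]
    (op : M → Γ → M → M) (hop : IsCompatible op) (μ σ : M → ℝ)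
    (hμ : IsFuzzyIdeal op μ) (hσ : IsFuzzyIdeal op σ) :
    ∀ t ∈ Set.Icc (0:ℝ) 1, (LevelSet (prodFuzzy μ σ) t).Nonempty →
      IsIdeal (prodOp op) (LevelSet (prodFuzzy μ σ) t) := by
  rintro t - hne
  obtain ⟨-, hμmul, hμle⟩ := hμ
  obtain ⟨-, hσmul, hσle⟩ := hσ
  have hlower : ∀ a ∈ LevelSet (prodFuzzy μ σ) t, ∀ b : M × M, b ≤ a →
      b ∈ LevelSet (prodFuzzy μ σ) t := fun _ ha _ hba =>
    le_trans ha (min_le_min (hμle hba.1) (hσle hba.2))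
  exact ⟨⟨hne, fun _ _ _ hb => le_trans hb (min_le_min
      ((le_max_right _ _).trans (hμmul _ _ _)) ((le_max_right _ _).trans (hσmul _ _ _))), hlower⟩,
    ⟨hne, fun _ ha _ _ => le_trans ha (min_le_min
      ((le_max_left _ _).trans (hμmul _ _ _)) ((le_max_left _ _).trans (hσmul _ _ _))), hlower⟩⟩
end
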